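/- Let Φ be a Euclidean ring and φ = (f₁, f₂) a tame automorphism of Φ[x₁,x₂]. If D(φ) ≻ (x₁, x₂, 2e), where e = |1|, then φ is elementarily D-reducible. -/

import Mathlib

open MvPolynomial

/-- The group of `Φ`-algebra automorphisms of `Φ[x₁,x₂]`. -/
abbrev PolyAut (Φ : Type*) [CommRing Φ] :=
  MvPolynomial (Fin 2) Φ ≃ₐ[Φ] MvPolynomial (Fin 2) Φ

/-- `Φ` together with `ν` is a Euclidean ring: an integral domain, not a field, with a norm
`ν` on nonzero elements such that (E1) `ν a ≤ ν (a*b)` with equality iff `b` is a unit, and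
(E2) division with remainder holds. -/
structure IsEuclideanNorm (Φ : Type*) [CommRing Φ] [IsDomain Φ] (ν : Φ → ℕ) : Prop where
  not_field : ¬ IsField Φ
  norm_le : ∀ a b : Φ, a ≠ 0 → b ≠ 0 → ν a ≤ ν (a * b)
  norm_eq_iff_unit : ∀ a b : Φ, a ≠ 0 → b ≠ 0 → (ν (a * b) = ν a ↔ IsUnit b)
  division : ∀ a b : Φ, b ≠ 0 → ∃ q r : Φ, a = b * q + r ∧ (r = 0 ∨ ν r < ν b)

/-- The monomial `x₁^l x₂^m` is encoded by the pair `(l + m, l)`; the lexicographic order on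
these pairs is exactly the order `u < v` iff `deg u < deg v`, or `deg u = deg v` and
`deg_{x₁} u < deg_{x₁} v`. -/
def mkey (d : Fin 2 →₀ ℕ) : ℕ ×ₗ ℕ := toLex (d 0 + d 1, d 0)

/-- The key of the leading monomial of `f`: the largest key of a monomial in the support. -/
noncomputable def leadKey {Φ : Type*} [CommRing Φ] (f : MvPolynomial (Fin 2) Φ) : ℕ ×ₗ ℕ :=
  f.support.sup mkey

/-- The leading monomial `f̄` of `f` (as an exponent vector). -/
noncomputable def leadMon {Φ : Type*} [CommRing Φ] (f : MvPolynomial (Fin 2) Φ) :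
    Fin 2 →₀ ℕ :=
  Finsupp.single 0 (ofLex (leadKey f)).2 +
    Finsupp.single 1 ((ofLex (leadKey f)).1 - (ofLex (leadKey f)).2)

/-- The leading coefficient `lc f` of `f`. -/
noncomputable def lc {Φ : Type*} [CommRing Φ] (f : MvPolynomial (Fin 2) Φ) : Φ :=
  f.coeff (leadMon f)

/-- The leading term `f′ = lc(f)·f̄` of `f`. -/
noncomputable def leadTerm {Φ : Type*} [CommRing Φ] (f : MvPolynomial (Fin 2) Φ) :
    MvPolynomial (Fin 2) Φ :=
  monomial (leadMon f) (lc f)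

/-- The value `D(φ) = (u, v, ν(lc f₁) + ν(lc f₂)) ∈ W² × ℕ` of an automorphism
`φ = (f₁, f₂)`, where `{u, v} = {f̄₁, f̄₂}`, `u ≥ v`, monomials being encoded by their keys,
and `W² × ℕ` carries the lexicographic order. -/
noncomputable def DAut {Φ : Type*} [CommRing Φ] (ν : Φ → ℕ) (φ : PolyAut Φ) :
    Lex ((ℕ ×ₗ ℕ) × Lex ((ℕ ×ₗ ℕ) × ℕ)) :=
  toLex (max (leadKey (φ (X 0))) (leadKey (φ (X 1))),
    toLex (min (leadKey (φ (X 0))) (leadKey (φ (X 1))),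
      ν (lc (φ (X 0))) + ν (lc (φ (X 1)))))

/-- The value `(x₁, x₂, 2e)` where `e = ν 1`. -/
def DId (e : ℕ) : Lex ((ℕ ×ₗ ℕ) × Lex ((ℕ ×ₗ ℕ) × ℕ)) :=
  toLex (toLex (1, 1), toLex (toLex (1, 0), 2 * e))

/-- `ψ` is obtained from `θ` by a single elementary transformation: one component `fᵢ` of
`θ = (f₁, f₂)` is replaced by `αfᵢ + g` with `α` a unit and `g` in the `Φ`-subalgebra
generated by the other component. -/
def ElemStep {Φ : Type*} [CommRing Φ] (θ ψ : PolyAut Φ) : Prop :=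
  (∃ (α : Φˣ) (g : MvPolynomial (Fin 2) Φ), g ∈ Algebra.adjoin Φ {θ (X 1)} ∧
      ψ (X 0) = C (α : Φ) * θ (X 0) + g ∧ ψ (X 1) = θ (X 1)) ∨
  (∃ (α : Φˣ) (g : MvPolynomial (Fin 2) Φ), g ∈ Algebra.adjoin Φ {θ (X 0)} ∧
      ψ (X 0) = θ (X 0) ∧ ψ (X 1) = C (α : Φ) * θ (X 1) + g)

/-- `θ` admits an elementary `D`-reduction: some elementary transformation of `θ` yields an
automorphism `ψ` with `D(ψ) ≺ D(θ)`. -/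
def ElemDReducible {Φ : Type*} [CommRing Φ] (ν : Φ → ℕ) (θ : PolyAut Φ) : Prop :=
  ∃ ψ : PolyAut Φ, ElemStep θ ψ ∧ DAut ν ψ < DAut ν θ

/-- An automorphism of `Φ[x₁,x₂]` is elementary if it has the form
`(x₁ ↦ αx₁ + f(x₂), x₂ ↦ x₂)` or `(x₁ ↦ x₁, x₂ ↦ βx₂ + g(x₁))` with `α, β` units. -/
def IsElementary {Φ : Type*} [CommRing Φ] (σ : PolyAut Φ) : Prop :=
  (∃ (α : Φˣ) (f : MvPolynomial (Fin 2) Φ), f ∈ Algebra.adjoin Φ {(X 1 : MvPolynomial (Fin 2) Φ)} ∧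
      σ (X 0) = C (α : Φ) * X 0 + f ∧ σ (X 1) = X 1) ∨
  (∃ (β : Φˣ) (g : MvPolynomial (Fin 2) Φ), g ∈ Algebra.adjoin Φ {(X 0 : MvPolynomial (Fin 2) Φ)} ∧
      σ (X 0) = X 0 ∧ σ (X 1) = C (β : Φ) * X 1 + g)

/-- The subgroup of tame automorphisms of `Φ[x₁,x₂]`, generated by the elementary ones. -/
noncomputable def TameSubgroup (Φ : Type*) [CommRing Φ] : Subgroup (PolyAut Φ) :=
  Subgroup.closure {σ | IsElementary σ}

section LeadingData

variable {Φ : Type*} [CommRing Φ]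

lemma mkey_injective : Function.Injective mkey := by
  intro d e h
  have h' : (d 0 + d 1, d 0) = (e 0 + e 1, e 0) := toLex.injective h
  simp only [Prod.mk.injEq] at h'
  ext i
  fin_cases i
  · exact h'.2
  · change d 1 = e 1
    omega

lemma mkey_add (d e : Fin 2 →₀ ℕ) : mkey (d + e) = mkey d + mkey e := by
  simp only [mkey, Finsupp.add_apply, ← toLex_add, Prod.mk_add_mk]
  congr 2
  omega

lemma bot_eq_zero_key : (⊥ : ℕ ×ₗ ℕ) = 0 := rfl

lemma key_nonneg (k : ℕ ×ₗ ℕ) : 0 ≤ k := bot_le (a := k)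

lemma leadKey_eq_supDegree (f : MvPolynomial (Fin 2) Φ) :
    leadKey f = AddMonoidAlgebra.supDegree mkey f := rfl

lemma mkey_leadMon (f : MvPolynomial (Fin 2) Φ) : mkey (leadMon f) = leadKey f := by
  by_cases hf : f = 0
  · subst hf
    simp [leadMon, leadKey, bot_eq_zero_key, mkey]
  obtain ⟨d, -, hd⟩ := AddMonoidAlgebra.exists_supDegree_mem_support mkey hf
  rw [leadMon, leadKey_eq_supDegree, hd]
  congr 1
  ext i
  fin_cases i <;> simp [mkey]

lemma lc_eq_leadingCoeff (f : MvPolynomial (Fin 2) Φ) :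
    lc f = AddMonoidAlgebra.leadingCoeff mkey f := by
  rw [lc, AddMonoidAlgebra.leadingCoeff, ← leadKey_eq_supDegree, ← mkey_leadMon,
    Function.leftInverse_invFun mkey_injective]
  rfl

lemma lc_ne_zero {f : MvPolynomial (Fin 2) Φ} : lc f ≠ 0 ↔ f ≠ 0 := by
  rw [lc_eq_leadingCoeff]
  exact AddMonoidAlgebra.leadingCoeff_ne_zero mkey_injective

lemma ne_zero_of_leadKey_pos {f : MvPolynomial (Fin 2) Φ} (hf : 0 < leadKey f) : f ≠ 0 := by
  rintro rfl
  simp [leadKey, bot_eq_zero_key] at hf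

lemma leadKey_monomial (d : Fin 2 →₀ ℕ) {a : Φ} (ha : a ≠ 0) :
    leadKey (monomial d a) = mkey d :=
  AddMonoidAlgebra.supDegree_single_ne_zero d ha

lemma lc_monomial (d : Fin 2 →₀ ℕ) (a : Φ) : lc (monomial d a) = a := by
  rw [lc_eq_leadingCoeff]
  exact AddMonoidAlgebra.leadingCoeff_single mkey_injective d a

lemma leadKey_C (a : Φ) : leadKey (C a : MvPolynomial (Fin 2) Φ) = 0 := by
  by_cases ha : a = 0
  · simp [ha, leadKey, bot_eq_zero_key]
  · exact leadKey_monomial 0 ha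

lemma leadKey_add_le (f g : MvPolynomial (Fin 2) Φ) :
    leadKey (f + g) ≤ max (leadKey f) (leadKey g) :=
  AddMonoidAlgebra.supDegree_add_le

lemma leadKey_add_eq_left {f g : MvPolynomial (Fin 2) Φ} (h : leadKey g < leadKey f) :
    leadKey (f + g) = leadKey f :=
  AddMonoidAlgebra.supDegree_add_eq_left h

lemma lc_add_eq_left {f g : MvPolynomial (Fin 2) Φ} (h : leadKey g < leadKey f) :
    lc (f + g) = lc f := by
  simp only [lc_eq_leadingCoeff]
  exact AddMonoidAlgebra.leadingCoeff_add_eq_left h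

/-- Subtracting a polynomial with the same leading term lowers the leading monomial. -/
lemma leadKey_sub_lt {f g : MvPolynomial (Fin 2) Φ} (hf : 0 < leadKey f)
    (hk : leadKey f = leadKey g) (hc : lc f = lc g) : leadKey (f - g) < leadKey f := by
  simp only [lc_eq_leadingCoeff] at hc
  rcases AddMonoidAlgebra.supDegree_sub_lt_of_leadingCoeff_eq mkey_injective hk hc with h | h
  · exact h
  · have h' : f = g := h
    subst h'
    rw [sub_self]
    simpa [leadKey, bot_eq_zero_key] using hf

/-- If the leading coefficients do not cancel, a difference of polynomials with the same leading
monomial has that leading monomial. -/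
lemma leadKey_sub_eq {f g : MvPolynomial (Fin 2) Φ} (hk : leadKey f = leadKey g)
    (hc : lc f ≠ lc g) : leadKey (f - g) = leadKey f ∧ lc (f - g) = lc f - lc g := by
  have hmon : leadMon f = leadMon g := by rw [leadMon, leadMon, hk]
  have hcoeff : (f - g).coeff (leadMon f) = lc f - lc g := by
    rw [coeff_sub, lc, lc, hmon]
  have hle : leadKey (f - g) ≤ leadKey f := by
    rw [sub_eq_add_neg]
    refine (leadKey_add_le _ _).trans (max_le le_rfl ?_)
    rw [hk]
    exact (AddMonoidAlgebra.supDegree_neg (D := mkey) (f := g)).le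
  have hge : leadKey f ≤ leadKey (f - g) := by
    rw [← mkey_leadMon]
    refine Finset.le_sup (f := mkey) ?_
    rw [mem_support_iff, hcoeff]
    exact sub_ne_zero.2 hc
  have heq := le_antisymm hle hge
  refine ⟨heq, ?_⟩
  rw [← hcoeff, lc, leadMon, heq, leadMon]

variable [IsDomain Φ]

lemma leadKey_mul {f g : MvPolynomial (Fin 2) Φ} (hf : f ≠ 0) (hg : g ≠ 0) :
    leadKey (f * g) = leadKey f + leadKey g := by
  refine AddMonoidAlgebra.supDegree_mul mkey_injective mkey_add ?_ hf hg
  rw [← lc_eq_leadingCoeff, ← lc_eq_leadingCoeff]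
  exact mul_ne_zero (lc_ne_zero.2 hf) (lc_ne_zero.2 hg)

lemma lc_mul (f g : MvPolynomial (Fin 2) Φ) : lc (f * g) = lc f * lc g := by
  simp only [lc_eq_leadingCoeff]
  exact AddMonoidAlgebra.leadingCoeff_mul mkey_injective mkey_add

lemma leadKey_C_mul {a : Φ} (ha : a ≠ 0) (f : MvPolynomial (Fin 2) Φ) :
    leadKey (C a * f) = leadKey f := by
  by_cases hf : f = 0
  · simp [hf]
  · rw [leadKey_mul (by simpa using ha) hf, leadKey_C, zero_add]

lemma leadKey_C_mul_le (a : Φ) (f : MvPolynomial (Fin 2) Φ) : leadKey (C a * f) ≤ leadKey f := by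
  by_cases ha : a = 0
  · subst ha
    rw [C_0, zero_mul, ← C_0, leadKey_C]
    exact key_nonneg _
  · exact (leadKey_C_mul ha f).le

lemma lc_C_mul (a : Φ) (f : MvPolynomial (Fin 2) Φ) : lc (C a * f) = a * lc f := by
  rw [lc_mul, C_apply, lc_monomial]

lemma leadKey_pow {f : MvPolynomial (Fin 2) Φ} (hf : f ≠ 0) (n : ℕ) :
    leadKey (f ^ n) = n • leadKey f := by
  induction n with
  | zero => rw [pow_zero, zero_smul, ← C_1, leadKey_C]
  | succ n ih => rw [pow_succ, leadKey_mul (pow_ne_zero n hf) hf, ih, succ_nsmul]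

lemma lc_pow (f : MvPolynomial (Fin 2) Φ) (n : ℕ) : lc (f ^ n) = lc f ^ n := by
  induction n with
  | zero => rw [pow_zero, pow_zero, ← C_1, C_apply, lc_monomial]
  | succ n ih => rw [pow_succ, lc_mul, ih, pow_succ]

/-- The leading monomial and the leading coefficient of `p(h)`, where `h` is not constant. -/
lemma leadKey_lc_aeval {h : MvPolynomial (Fin 2) Φ} (hh : 0 < leadKey h) {p : Polynomial Φ}
    (hp : p ≠ 0) :
    leadKey (Polynomial.aeval h p) = p.natDegree • leadKey h ∧
      lc (Polynomial.aeval h p) = p.leadingCoeff * lc h ^ p.natDegree := by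
  have hne := ne_zero_of_leadKey_pos hh
  have hlead : p.coeff p.natDegree ≠ 0 := Polynomial.leadingCoeff_ne_zero.2 hp
  have htop : leadKey (C (p.coeff p.natDegree) * h ^ p.natDegree) = p.natDegree • leadKey h := by
    rw [leadKey_C_mul hlead, leadKey_pow hne]
  have key := AddMonoidAlgebra.supDegree_leadingCoeff_sum_eq (D := mkey)
    (s := Finset.range (p.natDegree + 1)) (i := p.natDegree)
    (f := fun j => C (p.coeff j) * h ^ j) (Finset.self_mem_range_succ _) (by
      intro j hj hjn
      have hlt : j < p.natDegree := by
        have := Finset.mem_range.1 hj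
        omega
      change leadKey _ < leadKey _
      rw [htop]
      refine (leadKey_C_mul_le _ _).trans_lt ?_
      rw [leadKey_pow hne]
      exact nsmul_lt_nsmul_left hh hlt)
  have hsum : Polynomial.aeval h p =
      ∑ j ∈ Finset.range (p.natDegree + 1), C (p.coeff j) * h ^ j := by
    rw [Polynomial.aeval_eq_sum_range]
    simp [MvPolynomial.smul_eq_C_mul]
  rw [← lc_eq_leadingCoeff, ← lc_eq_leadingCoeff, ← leadKey_eq_supDegree,
    ← leadKey_eq_supDegree, ← hsum, htop, lc_C_mul, lc_pow] at key
  exact key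

end LeadingData

section Automorphisms

variable {Φ : Type*} [CommRing Φ]

/-- The elementary automorphism `(x₁ ↦ x₁ + p(x₂), x₂ ↦ x₂)`. -/
noncomputable def shear (p : Polynomial Φ) : PolyAut Φ :=
  AlgEquiv.ofAlgHom
    (aeval ![X 0 + Polynomial.aeval (X 1 : MvPolynomial (Fin 2) Φ) p, X 1])
    (aeval ![X 0 - Polynomial.aeval (X 1 : MvPolynomial (Fin 2) Φ) p, X 1])
    (by
      ext i : 1
      fin_cases i <;> simp [← Polynomial.aeval_algHom_apply])
    (by
      ext i : 1
      fin_cases i <;> simp [← Polynomial.aeval_algHom_apply])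

lemma mul_shear_X_zero (φ : PolyAut Φ) (p : Polynomial Φ) :
    (φ * shear p) (X 0) = φ (X 0) + Polynomial.aeval (φ (X 1)) p := by
  simp [shear, Polynomial.aeval_algHom_apply]

lemma mul_shear_X_one (φ : PolyAut Φ) (p : Polynomial Φ) :
    (φ * shear p) (X 1) = φ (X 1) := by
  simp [shear]

/-- The automorphism exchanging the two variables. -/
noncomputable def swapAut (Φ : Type*) [CommRing Φ] : PolyAut Φ :=
  renameEquiv Φ (Equiv.swap (0 : Fin 2) 1)

lemma mul_swapAut_X_zero (φ : PolyAut Φ) : (φ * swapAut Φ) (X 0) = φ (X 1) := by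
  simp [swapAut]

lemma mul_swapAut_X_one (φ : PolyAut Φ) : (φ * swapAut Φ) (X 1) = φ (X 0) := by
  simp [swapAut]

lemma DAut_mul_swapAut (ν : Φ → ℕ) (φ : PolyAut Φ) : DAut ν (φ * swapAut Φ) = DAut ν φ := by
  rw [DAut, DAut, mul_swapAut_X_zero, mul_swapAut_X_one, max_comm, min_comm, add_comm]

lemma ElemDReducible.of_mul_swapAut {ν : Φ → ℕ} {φ : PolyAut Φ}
    (h : ElemDReducible ν (φ * swapAut Φ)) : ElemDReducible ν φ := by
  obtain ⟨ψ, hstep, hlt⟩ := h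
  rw [DAut_mul_swapAut, ← DAut_mul_swapAut ν ψ] at hlt
  refine ⟨ψ * swapAut Φ, ?_, hlt⟩
  simp only [ElemStep, mul_swapAut_X_zero, mul_swapAut_X_one] at hstep ⊢
  rcases hstep with ⟨α, g, hg, h₀, h₁⟩ | ⟨α, g, hg, h₀, h₁⟩
  · exact Or.inr ⟨α, g, hg, h₁, h₀⟩
  · exact Or.inl ⟨α, g, hg, h₁, h₀⟩

lemma elemStep_mul_shear (φ : PolyAut Φ) (p : Polynomial Φ) : ElemStep φ (φ * shear p) := by
  refine Or.inl ⟨1, Polynomial.aeval (φ (X 1)) p, ?_, ?_, mul_shear_X_one φ p⟩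
  · rw [Algebra.adjoin_singleton_eq_range_aeval]
    exact ⟨p, rfl⟩
  · rw [mul_shear_X_zero, Units.val_one, C_1, one_mul]

/-- An elementary transformation which lowers the larger leading monomial is a `D`-reduction. -/
lemma elemDReducible_of_leadKey_lt (ν : Φ → ℕ) (φ : PolyAut Φ) (p : Polynomial Φ)
    (hle : leadKey (φ (X 1)) ≤ leadKey (φ (X 0)))
    (hlt : leadKey (φ (X 0) + Polynomial.aeval (φ (X 1)) p) < leadKey (φ (X 0))) :
    ElemDReducible ν φ := by
  refine ⟨φ * shear p, elemStep_mul_shear φ p, ?_⟩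
  rw [DAut, DAut, mul_shear_X_zero, mul_shear_X_one, max_eq_left hle, min_eq_right hle,
    Prod.Lex.toLex_lt_toLex]
  rcases hle.lt_or_eq with h | h
  · exact Or.inl (max_lt hlt h)
  · rw [h, max_eq_right hlt.le, min_eq_left hlt.le, Prod.Lex.toLex_lt_toLex]
    exact Or.inr ⟨rfl, Or.inl hlt⟩

variable [IsDomain Φ]

/-- If the leading term of `f₁` is a multiple of a power of the leading term of `f₂`, then
`(f₁, f₂)` is elementarily `D`-reducible. -/
lemma elemDReducible_of_leadKey_eq_nsmul (ν : Φ → ℕ) (φ : PolyAut Φ) {n : ℕ} (hn : 1 ≤ n) {t : Φ}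
    (hpos : 0 < leadKey (φ (X 1))) (hkey : leadKey (φ (X 0)) = n • leadKey (φ (X 1)))
    (hlc : lc (φ (X 0)) = t * lc (φ (X 1)) ^ n) : ElemDReducible ν φ := by
  have hpos' : 0 < leadKey (φ (X 0)) := hkey ▸ nsmul_pos hpos (by omega)
  have ht : t ≠ 0 := by
    rintro rfl
    rw [zero_mul] at hlc
    exact lc_ne_zero.2 (ne_zero_of_leadKey_pos hpos') hlc
  refine elemDReducible_of_leadKey_lt ν φ (-(Polynomial.C t * Polynomial.X ^ n)) ?_ ?_
  · rw [hkey]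
    exact le_self_nsmul hpos.le (by omega)
  · have hsub : φ (X 0) + Polynomial.aeval (φ (X 1)) (-(Polynomial.C t * Polynomial.X ^ n)) =
        φ (X 0) - C t * φ (X 1) ^ n := by
      simp [sub_eq_add_neg, MvPolynomial.algebraMap_eq]
    rw [hsub]
    refine leadKey_sub_lt hpos' ?_ ?_
    · rw [hkey, leadKey_C_mul ht, leadKey_pow (ne_zero_of_leadKey_pos hpos)]
    · rw [hlc, lc_C_mul, lc_pow]

/-- Two components with the same leading monomial can be reduced by dividing the leading
coefficients with remainder. -/
lemma elemDReducible_of_leadKey_eq {ν : Φ → ℕ} (hν : IsEuclideanNorm Φ ν) (φ : PolyAut Φ)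
    (hpos : 0 < leadKey (φ (X 0))) (hkey : leadKey (φ (X 0)) = leadKey (φ (X 1))) :
    ElemDReducible ν φ := by
  wlog hle : ν (lc (φ (X 1))) ≤ ν (lc (φ (X 0))) generalizing φ
  · refine ElemDReducible.of_mul_swapAut (this (φ * swapAut Φ) ?_ ?_ ?_) <;>
      rw [mul_swapAut_X_zero]
    · rwa [← hkey]
    · rw [mul_swapAut_X_one, hkey]
    · rw [mul_swapAut_X_one]
      exact (not_le.1 hle).le
  have hpos' : 0 < leadKey (φ (X 1)) := hkey ▸ hpos
  obtain ⟨q, r, hqr, hr⟩ := hν.division (lc (φ (X 0))) (lc (φ (X 1)))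
    (lc_ne_zero.2 (ne_zero_of_leadKey_pos hpos'))
  by_cases hr0 : r = 0
  · refine elemDReducible_of_leadKey_eq_nsmul ν φ le_rfl (t := q) hpos' ?_ ?_
    · rw [hkey, one_smul]
    · rw [hqr, hr0, pow_one, add_zero, mul_comm]
  have hlt := hr.resolve_left hr0
  have hq : q ≠ 0 := by
    rintro rfl
    rw [mul_zero, zero_add] at hqr
    rw [hqr] at hle
    omega
  obtain ⟨hk, hc⟩ := leadKey_sub_eq (f := φ (X 0)) (g := C q * φ (X 1))
    (by rw [leadKey_C_mul hq, hkey])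
    (by
      rw [lc_C_mul, hqr, mul_comm q]
      simpa using hr0)
  have hsub : φ (X 0) + Polynomial.aeval (φ (X 1)) (-(Polynomial.C q * Polynomial.X)) =
      φ (X 0) - C q * φ (X 1) := by
    simp [sub_eq_add_neg, MvPolynomial.algebraMap_eq]
  refine ⟨φ * shear (-(Polynomial.C q * Polynomial.X)), elemStep_mul_shear φ _, ?_⟩
  have hrem : lc (φ (X 0) - C q * φ (X 1)) = r := by
    rw [hc, lc_C_mul, hqr]
    ring
  rw [DAut, DAut, mul_shear_X_zero, mul_shear_X_one, hsub, hk, hrem, Prod.Lex.toLex_lt_toLex]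
  refine Or.inr ⟨rfl, ?_⟩
  rw [Prod.Lex.toLex_lt_toLex]
  refine Or.inr ⟨rfl, ?_⟩
  omega

end Automorphisms

section TamePairs

variable {Φ : Type*} [CommRing Φ]

/-- `(f₁, f₂)` is obtained from `(g₁, g₂)` by an invertible affine transformation. -/
def IsAffineImage (g₁ g₂ f₁ f₂ : MvPolynomial (Fin 2) Φ) : Prop :=
  ∃ a b r c d s : Φ, IsUnit (a * d - b * c) ∧
    f₁ = C a * g₁ + C b * g₂ + C r ∧ f₂ = C c * g₁ + C d * g₂ + C s

lemma IsAffineImage.refl (g₁ g₂ : MvPolynomial (Fin 2) Φ) : IsAffineImage g₁ g₂ g₁ g₂ :=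
  ⟨1, 0, 0, 0, 1, 0, by simp, by simp, by simp⟩

lemma IsAffineImage.swap {g₁ g₂ f₁ f₂ : MvPolynomial (Fin 2) Φ}
    (h : IsAffineImage g₁ g₂ f₁ f₂) : IsAffineImage g₁ g₂ f₂ f₁ := by
  obtain ⟨a, b, r, c, d, s, hu, h₁, h₂⟩ := h
  refine ⟨c, d, s, a, b, r, ?_, h₂, h₁⟩
  rw [← IsUnit.neg_iff]
  convert hu using 1
  ring

lemma IsAffineImage.trans {g₁ g₂ h₁ h₂ f₁ f₂ : MvPolynomial (Fin 2) Φ}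
    (h : IsAffineImage g₁ g₂ h₁ h₂) (h' : IsAffineImage h₁ h₂ f₁ f₂) :
    IsAffineImage g₁ g₂ f₁ f₂ := by
  obtain ⟨a, b, r, c, d, s, hu, rfl, rfl⟩ := h
  obtain ⟨a', b', r', c', d', s', hu', rfl, rfl⟩ := h'
  refine ⟨a' * a + b' * c, a' * b + b' * d, a' * r + b' * s + r',
    c' * a + d' * c, c' * b + d' * d, c' * r + d' * s + s', ?_, ?_, ?_⟩
  · convert hu'.mul hu using 1
    ring
  · simp only [map_add, map_mul]
    ring
  · simp only [map_add, map_mul]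
    ring

/-- The pairs of polynomials built from `(x₁, x₂)` by alternating invertible affine
transformations and transformations `(h₁, h₂) ↦ (h₁ + p(h₂), h₂)` with `deg p ≥ 2`, where the
latter may be applied only when `p(h₂)` dominates `h₁`. -/
inductive TamePair : MvPolynomial (Fin 2) Φ → MvPolynomial (Fin 2) Φ → Prop
  | affine (f₁ f₂ : MvPolynomial (Fin 2) Φ) (h : IsAffineImage (X 0) (X 1) f₁ f₂) :
      TamePair f₁ f₂
  | shear (h₁ h₂ f₁ f₂ : MvPolynomial (Fin 2) Φ) (p : Polynomial Φ) (hh : TamePair h₁ h₂)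
      (hp : 2 ≤ p.natDegree) (hlt : leadKey h₁ < 2 • leadKey h₂)
      (h : IsAffineImage (h₁ + Polynomial.aeval h₂ p) h₂ f₁ f₂) : TamePair f₁ f₂

lemma TamePair.of_affine {g₁ g₂ f₁ f₂ : MvPolynomial (Fin 2) Φ} (hg : TamePair g₁ g₂)
    (h : IsAffineImage g₁ g₂ f₁ f₂) : TamePair f₁ f₂ := by
  cases hg with
  | affine _ _ hg => exact .affine _ _ (hg.trans h)
  | shear h₁ h₂ _ _ p hh hp hlt hg => exact .shear h₁ h₂ _ _ p hh hp hlt (hg.trans h)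

lemma TamePair.swap {f₁ f₂ : MvPolynomial (Fin 2) Φ} (h : TamePair f₁ f₂) : TamePair f₂ f₁ :=
  h.of_affine (IsAffineImage.refl f₁ f₂).swap

/-- Adding a polynomial in the second component, when it dominates the first one. -/
lemma TamePair.add_aeval_of_lt {f₁ f₂ : MvPolynomial (Fin 2) Φ} (h : TamePair f₁ f₂)
    (hlt : leadKey f₁ < 2 • leadKey f₂) (p : Polynomial Φ) :
    TamePair (f₁ + Polynomial.aeval f₂ p) f₂ := by
  by_cases hp : p.natDegree ≤ 1
  · obtain ⟨u, v, rfl⟩ := Polynomial.exists_eq_X_add_C_of_natDegree_le_one hp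
    refine h.of_affine ⟨1, u, v, 0, 1, 0, by simp, ?_, by simp⟩
    simp [MvPolynomial.algebraMap_eq, add_assoc]
  · exact .shear f₁ f₂ _ _ p h (by omega) hlt (IsAffineImage.refl _ _)

lemma lc_X (i : Fin 2) : lc (X i : MvPolynomial (Fin 2) Φ) = 1 :=
  lc_monomial _ _

lemma leadKey_pos_of_lt_two_nsmul {h₁ h₂ : MvPolynomial (Fin 2) Φ}
    (hlt : leadKey h₁ < 2 • leadKey h₂) : 0 < leadKey h₂ :=
  (key_nonneg _).lt_of_ne fun h => by
    rw [← h, nsmul_zero] at hlt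
    exact hlt.not_ge (key_nonneg _)

lemma lt_nsmul_of_pos {k : ℕ ×ₗ ℕ} (hk : 0 < k) {n : ℕ} (hn : 2 ≤ n) : k < n • k := by
  simpa using nsmul_lt_nsmul_left hk (show 1 < n by omega)

lemma map_mem_adjoin_singleton (φ : PolyAut Φ) {f g : MvPolynomial (Fin 2) Φ}
    (hg : g ∈ Algebra.adjoin Φ {f}) : φ g ∈ Algebra.adjoin Φ {φ f} := by
  rw [Algebra.adjoin_singleton_eq_range_aeval] at hg ⊢
  obtain ⟨p, rfl⟩ := hg
  exact ⟨p, Polynomial.aeval_algHom_apply φ f p⟩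

lemma neg_C_mul_mem_adjoin_singleton {f g : MvPolynomial (Fin 2) Φ} (a : Φ)
    (hg : g ∈ Algebra.adjoin Φ {f}) : -(C a * g) ∈ Algebra.adjoin Φ {f} :=
  neg_mem (mul_mem (Subalgebra.algebraMap_mem _ a) hg)

lemma inv_apply_of_apply_eq_unit_mul_add {σ : PolyAut Φ} {x y f : MvPolynomial (Fin 2) Φ}
    {α : Φˣ} (hf : f ∈ Algebra.adjoin Φ {y}) (hx : σ x = C (α : Φ) * x + f) (hy : σ y = y) :
    σ⁻¹ x = C (↑α⁻¹ : Φ) * x + -(C (↑α⁻¹ : Φ) * f) := by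
  have hα : (C (↑α⁻¹ : Φ) * C (α : Φ) : MvPolynomial (Fin 2) Φ) = 1 := by
    rw [← C_mul, Units.inv_mul, C_1]
  have hσf : σ f = f := by
    rw [Algebra.adjoin_singleton_eq_range_aeval] at hf
    obtain ⟨p, rfl⟩ := hf
    change σ (Polynomial.aeval y p) = _
    rw [← Polynomial.aeval_algHom_apply, hy]
    rfl
  have hC : ∀ a : Φ, σ (C a) = C a := σ.commutes
  change σ.symm x = _
  rw [AlgEquiv.symm_apply_eq, map_add, map_neg, map_mul, map_mul, hx, hσf, hC]
  linear_combination (-x) * hα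

lemma IsElementary.inv {σ : PolyAut Φ} (hσ : IsElementary σ) : IsElementary σ⁻¹ := by
  have hfix : ∀ y, σ y = y → σ⁻¹ y = y := fun y hy => (AlgEquiv.symm_apply_eq σ).2 hy.symm
  rcases hσ with ⟨α, f, hf, h₀, h₁⟩ | ⟨α, f, hf, h₀, h₁⟩
  · exact Or.inl ⟨α⁻¹, _, neg_C_mul_mem_adjoin_singleton _ hf,
      inv_apply_of_apply_eq_unit_mul_add hf h₀ h₁, hfix _ h₁⟩
  · exact Or.inr ⟨α⁻¹, _, neg_C_mul_mem_adjoin_singleton _ hf, hfix _ h₀,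
      inv_apply_of_apply_eq_unit_mul_add hf h₁ h₀⟩

variable [IsDomain Φ]

lemma leadKey_X_zero : leadKey (X 0 : MvPolynomial (Fin 2) Φ) = toLex (1, 1) :=
  (leadKey_monomial _ one_ne_zero).trans (by simp [mkey])

lemma leadKey_X_one : leadKey (X 1 : MvPolynomial (Fin 2) Φ) = toLex (1, 0) :=
  (leadKey_monomial _ one_ne_zero).trans (by simp [mkey])

lemma leadKey_X_one_pos : 0 < leadKey (X 1 : MvPolynomial (Fin 2) Φ) := by
  rw [leadKey_X_one]
  decide

lemma leadKey_X_one_lt :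
    leadKey (X 1 : MvPolynomial (Fin 2) Φ) < leadKey (X 0 : MvPolynomial (Fin 2) Φ) := by
  rw [leadKey_X_zero, leadKey_X_one]
  decide

lemma leadKey_affine_of_ne_zero {g₁ g₂ : MvPolynomial (Fin 2) Φ} (hpos : 0 < leadKey g₁)
    (hlt : leadKey g₂ < leadKey g₁) {a : Φ} (ha : a ≠ 0) (b r : Φ) :
    leadKey (C a * g₁ + C b * g₂ + C r) = leadKey g₁ ∧
      lc (C a * g₁ + C b * g₂ + C r) = a * lc g₁ := by
  have h : leadKey (C b * g₂ + C r) < leadKey (C a * g₁) := by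
    rw [leadKey_C_mul ha]
    refine (leadKey_add_le _ _).trans_lt (max_lt ((leadKey_C_mul_le _ _).trans_lt hlt) ?_)
    rwa [leadKey_C]
  rw [add_assoc, leadKey_add_eq_left h, lc_add_eq_left h, leadKey_C_mul ha, lc_C_mul]
  exact ⟨rfl, rfl⟩

lemma leadKey_affine_of_eq_zero {g₁ g₂ : MvPolynomial (Fin 2) Φ} (hpos : 0 < leadKey g₂)
    {d : Φ} (hd : d ≠ 0) (s : Φ) :
    leadKey (C 0 * g₁ + C d * g₂ + C s) = leadKey g₂ ∧
      lc (C 0 * g₁ + C d * g₂ + C s) = d * lc g₂ := by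
  have h : leadKey (C s : MvPolynomial (Fin 2) Φ) < leadKey (C d * g₂) := by
    rwa [leadKey_C_mul hd, leadKey_C]
  rw [C_0, zero_mul, zero_add, leadKey_add_eq_left h, lc_add_eq_left h, leadKey_C_mul hd, lc_C_mul]
  exact ⟨rfl, rfl⟩

lemma leadKey_affine_le {g₁ g₂ : MvPolynomial (Fin 2) Φ} (hlt : leadKey g₂ < leadKey g₁)
    (a b r : Φ) : leadKey (C a * g₁ + C b * g₂ + C r) ≤ leadKey g₁ := by
  refine (leadKey_add_le _ _).trans (max_le ((leadKey_add_le _ _).trans (max_le ?_ ?_)) ?_)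
  · exact leadKey_C_mul_le _ _
  · exact (leadKey_C_mul_le _ _).trans hlt.le
  · rw [leadKey_C]
    exact key_nonneg _

lemma leadKey_lc_add_aeval {h₁ h₂ : MvPolynomial (Fin 2) Φ}
    (hlt : leadKey h₁ < 2 • leadKey h₂) {p : Polynomial Φ} (hp : 2 ≤ p.natDegree) :
    leadKey (h₁ + Polynomial.aeval h₂ p) = p.natDegree • leadKey h₂ ∧
      lc (h₁ + Polynomial.aeval h₂ p) = p.leadingCoeff * lc h₂ ^ p.natDegree := by
  have hpos := leadKey_pos_of_lt_two_nsmul hlt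
  have hp0 : p ≠ 0 := by
    rintro rfl
    simp at hp
  obtain ⟨hk, hc⟩ := leadKey_lc_aeval hpos hp0
  have hlt' : leadKey h₁ < leadKey (Polynomial.aeval h₂ p) := by
    rw [hk]
    exact hlt.trans_le (nsmul_le_nsmul_left hpos.le hp)
  rw [add_comm, leadKey_add_eq_left hlt', lc_add_eq_left hlt']
  exact ⟨hk, hc⟩

lemma leadKey_lt_leadKey_add_aeval {h₁ h₂ : MvPolynomial (Fin 2) Φ}
    (hlt : leadKey h₁ < 2 • leadKey h₂) {p : Polynomial Φ} (hp : 2 ≤ p.natDegree) :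
    leadKey h₂ < leadKey (h₁ + Polynomial.aeval h₂ p) := by
  rw [(leadKey_lc_add_aeval hlt hp).1]
  exact lt_nsmul_of_pos (leadKey_pos_of_lt_two_nsmul hlt) hp

/-- Tame pairs are stable under adding a polynomial in one component to the other one. -/
lemma TamePair.add_aeval {f₁ f₂ : MvPolynomial (Fin 2) Φ} (h : TamePair f₁ f₂)
    (p : Polynomial Φ) : TamePair (f₁ + Polynomial.aeval f₂ p) f₂ := by
  cases h with
  | affine _ _ h =>
    refine (TamePair.affine _ _ h).add_aeval_of_lt ?_ p
    obtain ⟨a, b, r, c, d, s, hu, rfl, rfl⟩ := h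
    have hlt := leadKey_X_one_lt (Φ := Φ)
    have hpos := leadKey_X_one_pos (Φ := Φ)
    refine (leadKey_affine_le hlt _ _ _).trans_lt ?_
    by_cases hc : c = 0
    · subst hc
      have hd : d ≠ 0 := by
        rintro rfl
        simp at hu
      rw [(leadKey_affine_of_eq_zero hpos hd _).1, leadKey_X_zero, leadKey_X_one]
      decide
    · rw [(leadKey_affine_of_ne_zero (hpos.trans hlt) hlt hc _ _).1]
      exact lt_nsmul_of_pos (hpos.trans hlt) le_rfl
  | shear h₁ h₂ _ _ p₀ hh hp₀ hlt h =>
    have hpos := leadKey_pos_of_lt_two_nsmul hlt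
    have hlt' := leadKey_lt_leadKey_add_aeval hlt hp₀
    have hf := TamePair.shear h₁ h₂ _ _ p₀ hh hp₀ hlt h
    obtain ⟨a, b, r, c, d, s, hu, rfl, rfl⟩ := h
    by_cases hc : c = 0
    · subst hc
      rw [mul_zero, sub_zero] at hu
      obtain ⟨⟨a, rfl⟩, hd⟩ := IsUnit.mul_iff.1 hu
      set q : Polynomial Φ := Polynomial.C b * Polynomial.X + Polynomial.C r +
        p.comp (Polynomial.C d * Polynomial.X + Polynomial.C s) with hq
      have hqe : Polynomial.aeval h₂ q =
          C b * h₂ + C r + Polynomial.aeval (C 0 * (h₁ + Polynomial.aeval h₂ p₀) +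
            C d * h₂ + C s) p := by
        simp [hq, Polynomial.aeval_comp, MvPolynomial.algebraMap_eq]
      refine (hh.add_aeval_of_lt hlt (p₀ + Polynomial.C (↑a⁻¹ : Φ) * q)).of_affine
        ⟨a, 0, 0, 0, d, s, by simpa using hd, ?_, by simp⟩
      have ha : (C (a : Φ) * C (↑a⁻¹ : Φ) : MvPolynomial (Fin 2) Φ) = 1 := by
        rw [← C_mul, Units.mul_inv, C_1]
      rw [map_add, map_mul, Polynomial.aeval_C, MvPolynomial.algebraMap_eq, C_0]
      rw [C_0] at hqe
      linear_combination -hqe - Polynomial.aeval h₂ q * ha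
    · refine hf.add_aeval_of_lt ((leadKey_affine_le hlt' _ _ _).trans_lt ?_) p
      rw [(leadKey_affine_of_ne_zero (hpos.trans hlt') hlt' hc _ _).1]
      exact lt_nsmul_of_pos (hpos.trans hlt') le_rfl

lemma TamePair.unit_mul_add {f₁ f₂ g : MvPolynomial (Fin 2) Φ} (h : TamePair f₁ f₂) (α : Φˣ)
    (hg : g ∈ Algebra.adjoin Φ {f₂}) : TamePair (C (α : Φ) * f₁ + g) f₂ := by
  rw [Algebra.adjoin_singleton_eq_range_aeval] at hg
  obtain ⟨p, rfl⟩ := hg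
  exact (h.of_affine (f₁ := C (α : Φ) * f₁) (f₂ := f₂)
    ⟨α, 0, 0, 0, 1, 0, by simp, by simp, by simp⟩).add_aeval p

lemma TamePair.mul_elementary {φ σ : PolyAut Φ} (h : TamePair (φ (X 0)) (φ (X 1)))
    (hσ : IsElementary σ) : TamePair ((φ * σ) (X 0)) ((φ * σ) (X 1)) := by
  rw [AlgEquiv.mul_apply, AlgEquiv.mul_apply]
  rcases hσ with ⟨α, f, hf, h₀, h₁⟩ | ⟨α, f, hf, h₀, h₁⟩
  · rw [h₀, h₁, map_add, map_mul, ← MvPolynomial.algebraMap_eq, AlgEquiv.commutes]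
    exact h.unit_mul_add α (map_mem_adjoin_singleton φ hf)
  · rw [h₀, h₁, map_add, map_mul, ← MvPolynomial.algebraMap_eq, AlgEquiv.commutes]
    exact (h.swap.unit_mul_add α (map_mem_adjoin_singleton φ hf)).swap

lemma TamePair.of_mem_tameSubgroup {φ : PolyAut Φ} (hφ : φ ∈ TameSubgroup Φ) :
    TamePair (φ (X 0)) (φ (X 1)) := by
  induction hφ using Subgroup.closure_induction_right with
  | one => exact .affine _ _ (IsAffineImage.refl _ _)
  | mul_right φ _ σ hσ ih => exact ih.mul_elementary hσ
  | mul_inv_cancel φ _ σ hσ ih => exact ih.mul_elementary (IsElementary.inv hσ)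

lemma IsEuclideanNorm.norm_unit {ν : Φ → ℕ} (hν : IsEuclideanNorm Φ ν) {a : Φ} (ha : IsUnit a) :
    ν a = ν 1 := by
  simpa using (hν.norm_eq_iff_unit 1 a one_ne_zero ha.ne_zero).2 ha

/-- An affine image of a pair `(g₁, g₂)` with distinct leading monomials is reducible unless it
has, up to order and unit factors, the same leading terms. -/
lemma IsAffineImage.elemDReducible {ν : Φ → ℕ} (hν : IsEuclideanNorm Φ ν) {φ : PolyAut Φ}
    {g₁ g₂ : MvPolynomial (Fin 2) Φ} (hpos : 0 < leadKey g₂) (hlt : leadKey g₂ < leadKey g₁)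
    (h : IsAffineImage g₁ g₂ (φ (X 0)) (φ (X 1)))
    (hred : ∀ (ψ : PolyAut Φ) (a d : Φˣ), DAut ν ψ = DAut ν φ →
      leadKey (ψ (X 0)) = leadKey g₁ → leadKey (ψ (X 1)) = leadKey g₂ →
      lc (ψ (X 0)) = a * lc g₁ → lc (ψ (X 1)) = d * lc g₂ → ElemDReducible ν ψ) :
    ElemDReducible ν φ := by
  have hpos' := hpos.trans hlt
  obtain ⟨a, b, r, c, d, s, hu, h₀, h₁⟩ := h
  by_cases hc : c = 0
  · subst hc
    rw [mul_zero, sub_zero] at hu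
    obtain ⟨⟨a, rfl⟩, ⟨d, rfl⟩⟩ := IsUnit.mul_iff.1 hu
    obtain ⟨hk₀, hc₀⟩ := leadKey_affine_of_ne_zero hpos' hlt a.ne_zero b r
    obtain ⟨hk₁, hc₁⟩ := leadKey_affine_of_eq_zero (g₁ := g₁) hpos d.ne_zero s
    rw [← h₀] at hk₀ hc₀
    rw [← h₁] at hk₁ hc₁
    exact hred φ a d rfl hk₀ hk₁ hc₀ hc₁
  by_cases ha : a = 0
  · subst ha
    rw [zero_mul, zero_sub, IsUnit.neg_iff] at hu
    obtain ⟨⟨b, rfl⟩, ⟨c, rfl⟩⟩ := IsUnit.mul_iff.1 hu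
    obtain ⟨hk₀, hc₀⟩ := leadKey_affine_of_eq_zero (g₁ := g₁) hpos b.ne_zero r
    obtain ⟨hk₁, hc₁⟩ := leadKey_affine_of_ne_zero hpos' hlt c.ne_zero d s
    rw [← h₀] at hk₀ hc₀
    rw [← h₁] at hk₁ hc₁
    refine ElemDReducible.of_mul_swapAut (hred _ c b (DAut_mul_swapAut ν φ) ?_ ?_ ?_ ?_) <;>
      simpa only [mul_swapAut_X_zero, mul_swapAut_X_one]
  · have hk₀ := (leadKey_affine_of_ne_zero hpos' hlt ha b r).1
    have hk₁ := (leadKey_affine_of_ne_zero hpos' hlt hc d s).1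
    rw [← h₀] at hk₀
    rw [← h₁] at hk₁
    exact elemDReducible_of_leadKey_eq hν φ (hk₀ ▸ hpos') (hk₀.trans hk₁.symm)

end TamePairs

/-- If `φ` is a tame automorphism of `Φ[x₁,x₂]` over a Euclidean ring `Φ` and
`D(φ) ≻ (x₁, x₂, 2e)` where `e = ν 1`, then `φ` is elementarily `D`-reducible. -/
theorem tame_elemDReducible
    (Φ : Type*) [CommRing Φ] [IsDomain Φ] (ν : Φ → ℕ) (hν : IsEuclideanNorm Φ ν)
    (φ : PolyAut Φ) (hφ : φ ∈ TameSubgroup Φ)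
    (hD : DId (ν 1) < DAut ν φ) :
    ElemDReducible ν φ := by
  have hpair := TamePair.of_mem_tameSubgroup hφ
  cases hpair with
  | affine _ _ h =>
    refine h.elemDReducible hν leadKey_X_one_pos leadKey_X_one_lt ?_
    intro ψ a d hψ hk₀ hk₁ hc₀ hc₁
    have hmax := (leadKey_X_one_lt (Φ := Φ)).le
    refine absurd hD (not_lt_of_ge (le_of_eq ?_))
    rw [← hψ, DAut, hk₀, hk₁, max_eq_left hmax, min_eq_right hmax, hc₀, hc₁, lc_X, lc_X, mul_one,
      mul_one, hν.norm_unit a.isUnit, hν.norm_unit d.isUnit, leadKey_X_zero, leadKey_X_one, DId,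
      two_mul]
  | shear h₁ h₂ _ _ p _ hp hlt h =>
    have hpos := leadKey_pos_of_lt_two_nsmul hlt
    obtain ⟨hk, hc⟩ := leadKey_lc_add_aeval hlt hp
    refine h.elemDReducible hν hpos (leadKey_lt_leadKey_add_aeval hlt hp) ?_
    intro ψ a d _ hk₀ hk₁ hc₀ hc₁
    refine elemDReducible_of_leadKey_eq_nsmul ν ψ (n := p.natDegree)
      (t := a * p.leadingCoeff * (↑d⁻¹ : Φ) ^ p.natDegree) (by omega) (hk₁ ▸ hpos) ?_ ?_
    · rw [hk₀, hk₁, hk]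
    · have hd : (↑d⁻¹ : Φ) ^ p.natDegree * (d : Φ) ^ p.natDegree = 1 := by
        rw [← mul_pow, Units.inv_mul, one_pow]
      rw [hc₀, hc₁, hc, mul_pow]
      linear_combination (-(a * p.leadingCoeff * lc h₂ ^ p.natDegree)) * hd
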